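/- Let g be a finite-dimensional complex simple Lie algebra of rank 2, and let K and Φ satisfy the complexified system: each K_Z is skew with respect to ⟨·,·⟩ = −κ(·,·), Tr(K_Z ∘ ad_U) = 0 for all Z,U, (i) σ_{XYZ}⟨Φ(X,Y),Z⟩ = 0, and (ii) σ_{XYZ}([ad_{[X,Y]}, K_Z] + ad_{[K_X Y − K_Y X, Z]} + Φ(X,Y)∧Z) = 0. If X and Y span a Cartan subalgebra h of g and Z ∈ g satisfies κ(Z,W) = 0 for all W ∈ h, then ⟨K_Z X, Y⟩ = 0. -/

import Mathlib

open LieAlgebra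

/-- The inner product `⟨X,Y⟩ = -κ(X,Y)`, the negative of the Killing form. -/
noncomputable def ip (R : Type*) (g : Type*) [CommRing R] [LieRing g] [LieAlgebra R g]
    (X Y : g) : R :=
  - killingForm R g X Y

/-- The endomorphism `X ∧ Y : Z ↦ ⟨X,Z⟩Y - ⟨Y,Z⟩X`, where `⟨·,·⟩ = -κ(·,·)`. -/
noncomputable def wedge (R : Type*) (g : Type*) [CommRing R] [LieRing g] [LieAlgebra R g]
    (X Y : g) : Module.End R g :=
  (-(killingForm R g X)).smulRight Y - (-(killingForm R g Y)).smulRight X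

section Curvature

variable {R g : Type*} [CommRing R] [LieRing g] [LieAlgebra R g]

theorem ip_comm (X Y : g) : ip R g X Y = ip R g Y X := by
  simp only [ip, LieModule.traceForm_comm R g g X Y, killingForm]

theorem ip_lie_left (X Y Z : g) : ip R g ⁅X, Y⁆ Z = ip R g X ⁅Y, Z⁆ := by
  simp only [ip, killingForm, LieModule.traceForm_apply_lie_apply]

theorem wedge_apply (X Y Z : g) :
    wedge R g X Y Z = ip R g X Z • Y - ip R g Y Z • X := by
  simp [wedge, ip]

theorem ip_add_left (X Y Z : g) : ip R g (X + Y) Z = ip R g X Z + ip R g Y Z := by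
  simp [ip]; ring

theorem ip_add_right (X Y Z : g) : ip R g X (Y + Z) = ip R g X Y + ip R g X Z := by
  simp [ip]; ring

theorem ip_smul_left (a : R) (X Y : g) : ip R g (a • X) Y = a * ip R g X Y := by
  simp [ip]

theorem ip_smul_right (a : R) (X Y : g) : ip R g X (a • Y) = a * ip R g X Y := by
  simp [ip]

theorem ip_neg_left (X Y : g) : ip R g (-X) Y = -ip R g X Y := by simp [ip]

theorem ip_neg_right (X Y : g) : ip R g X (-Y) = -ip R g X Y := by simp [ip]

theorem ip_zero_left (X : g) : ip R g 0 X = 0 := by simp [ip]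

theorem ip_zero_right (X : g) : ip R g X 0 = 0 := by simp [ip]

theorem ip_sub_left (X Y Z : g) : ip R g (X - Y) Z = ip R g X Z - ip R g Y Z := by
  simp [ip]; ring

/-- One cyclic summand of the second equation, paired with `A` and `C`. -/
theorem ip_summand_apply {K : g →ₗ[R] Module.End R g}
    (hskew : ∀ Z X Y : g, ip R g (K Z X) Y + ip R g X (K Z Y) = 0)
    (P X Y Z A C : g) :
    ip R g ((⁅ad R g ⁅X, Y⁆, K Z⁆ + ad R g ⁅K X Y - K Y X, Z⁆ + wedge R g P Z) A) C =
      -ip R g (K Z A) ⁅⁅X, Y⁆, C⁆ + ip R g (K Z C) ⁅⁅X, Y⁆, A⁆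
        + (ip R g (K X Y) ⁅Z, ⁅A, C⁆⁆ - ip R g (K Y X) ⁅Z, ⁅A, C⁆⁆)
        + (ip R g P A * ip R g Z C - ip R g Z A * ip R g P C) := by
  have h1 : ip R g ⁅⁅X, Y⁆, K Z A⁆ C = -ip R g (K Z A) ⁅⁅X, Y⁆, C⁆ := by
    rw [← lie_skew, ip_neg_left, ip_lie_left]
  have h2 : ip R g (K Z ⁅⁅X, Y⁆, A⁆) C = -ip R g (K Z C) ⁅⁅X, Y⁆, A⁆ := by
    rw [eq_neg_iff_add_eq_zero, ip_comm (K Z C)]; exact hskew _ _ _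
  have h3 : ip R g ⁅⁅K X Y - K Y X, Z⁆, A⁆ C =
      ip R g (K X Y) ⁅Z, ⁅A, C⁆⁆ - ip R g (K Y X) ⁅Z, ⁅A, C⁆⁆ := by
    rw [ip_lie_left, ip_lie_left, ip_sub_left]
  simp only [LinearMap.add_apply, LinearMap.sub_apply, Ring.lie_def, Module.End.mul_apply,
    LieAlgebra.ad_apply, wedge_apply, ip_add_left, ip_sub_left, ip_smul_left, h1, h2, h3]
  ring

theorem ip_cyclic_sum_apply {K : g →ₗ[R] Module.End R g}
    (hskew : ∀ Z X Y : g, ip R g (K Z X) Y + ip R g X (K Z Y) = 0)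
    {Φ : g →ₗ[R] g →ₗ[R] g}
    (hii : ∀ X Y Z : g,
      (⁅ad R g ⁅X, Y⁆, K Z⁆ + ad R g ⁅K X Y - K Y X, Z⁆ + wedge R g (Φ X Y) Z)
      + (⁅ad R g ⁅Y, Z⁆, K X⁆ + ad R g ⁅K Y Z - K Z Y, X⁆ + wedge R g (Φ Y Z) X)
      + (⁅ad R g ⁅Z, X⁆, K Y⁆ + ad R g ⁅K Z X - K X Z, Y⁆ + wedge R g (Φ Z X) Y) = 0)
    (X Y Z A C : g) :
    (-ip R g (K Z A) ⁅⁅X, Y⁆, C⁆ + ip R g (K Z C) ⁅⁅X, Y⁆, A⁆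
        + (ip R g (K X Y) ⁅Z, ⁅A, C⁆⁆ - ip R g (K Y X) ⁅Z, ⁅A, C⁆⁆)
        + (ip R g (Φ X Y) A * ip R g Z C - ip R g Z A * ip R g (Φ X Y) C))
      + (-ip R g (K X A) ⁅⁅Y, Z⁆, C⁆ + ip R g (K X C) ⁅⁅Y, Z⁆, A⁆
        + (ip R g (K Y Z) ⁅X, ⁅A, C⁆⁆ - ip R g (K Z Y) ⁅X, ⁅A, C⁆⁆)
        + (ip R g (Φ Y Z) A * ip R g X C - ip R g X A * ip R g (Φ Y Z) C))
      + (-ip R g (K Y A) ⁅⁅Z, X⁆, C⁆ + ip R g (K Y C) ⁅⁅Z, X⁆, A⁆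
        + (ip R g (K Z X) ⁅Y, ⁅A, C⁆⁆ - ip R g (K X Z) ⁅Y, ⁅A, C⁆⁆)
        + (ip R g (Φ Z X) A * ip R g Y C - ip R g Y A * ip R g (Φ Z X) C)) = 0 := by
  simp only [← ip_summand_apply hskew, ← ip_add_left, ← LinearMap.add_apply, hii]
  simp [ip_zero_left]

/-- Root vectors `E, F` of weights `±γ` and `B, C` of weights `±β`, where `γ + β` is not a root, and
the basis `u, v` of the Cartan subalgebra dual to `β, γ`. The scalars `p, q, r` are the inner
products of the roots, `⟨γ, γ⟩`, `⟨γ, β⟩` and `⟨β, β⟩`. -/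
theorem mul_ip_rootVector_eq_zero [NoZeroDivisors R] [CharZero R] {K : g →ₗ[R] Module.End R g}
    (hskew : ∀ Z X Y : g, ip R g (K Z X) Y + ip R g X (K Z Y) = 0)
    {Φ : g →ₗ[R] g →ₗ[R] g}
    (hii : ∀ X Y Z : g,
      (⁅ad R g ⁅X, Y⁆, K Z⁆ + ad R g ⁅K X Y - K Y X, Z⁆ + wedge R g (Φ X Y) Z)
      + (⁅ad R g ⁅Y, Z⁆, K X⁆ + ad R g ⁅K Y Z - K Z Y, X⁆ + wedge R g (Φ Y Z) X)
      + (⁅ad R g ⁅Z, X⁆, K Y⁆ + ad R g ⁅K Z X - K X Z, Y⁆ + wedge R g (Φ Z X) Y) = 0)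
    {E F B C u v : g} {p q r : R}
    (huE : ⁅u, E⁆ = 0) (huF : ⁅u, F⁆ = 0) (huB : ⁅u, B⁆ = B) (huC : ⁅u, C⁆ = -C)
    (hvE : ⁅v, E⁆ = E) (hvF : ⁅v, F⁆ = -F) (hvB : ⁅v, B⁆ = 0) (hvC : ⁅v, C⁆ = 0)
    (huv : ⁅u, v⁆ = 0) (hEB : ⁅E, B⁆ = 0)
    (hEF : ⁅E, F⁆ = q • u + p • v) (hBC : ⁅B, C⁆ = r • u + q • v)
    (kEF : ip R g E F = 1) (kBC : ip R g B C = 1)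
    (kEE : ip R g E E = 0) (kEB : ip R g E B = 0) (kEC : ip R g E C = 0)
    (kuE : ip R g u E = 0) (kuF : ip R g u F = 0) (kuB : ip R g u B = 0) (kuC : ip R g u C = 0)
    (kvE : ip R g v E = 0) (kvF : ip R g v F = 0) (kvB : ip R g v B = 0) (kvC : ip R g v C = 0) :
    ((p + r) ^ 2 - 4 * q ^ 2) * ip R g (K E u) v = 0 := by
  have key := ip_cyclic_sum_apply hskew hii
  have skew : ∀ a b c, ip R g (K a b) c = -ip R g (K a c) b := fun a b c ↦ by
    rw [eq_neg_iff_add_eq_zero, ip_comm (K a c)]; exact hskew _ _ _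
  have huF' : ⁅F, u⁆ = 0 := by rw [← lie_skew, huF, neg_zero]
  have huB' : ⁅B, u⁆ = -B := by rw [← lie_skew, huB]
  have huC' : ⁅C, u⁆ = C := by rw [← lie_skew, huC, neg_neg]
  have hvE' : ⁅E, v⁆ = -E := by rw [← lie_skew, hvE]
  have hvF' : ⁅F, v⁆ = F := by rw [← lie_skew, hvF, neg_neg]
  have hvB' : ⁅B, v⁆ = 0 := by rw [← lie_skew, hvB, neg_zero]
  have hvC' : ⁅C, v⁆ = 0 := by rw [← lie_skew, hvC, neg_zero]
  have hvu : ⁅v, u⁆ = 0 := by rw [← lie_skew, huv, neg_zero]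
  have hBE : ⁅B, E⁆ = 0 := by rw [← lie_skew, hEB, neg_zero]
  have hFE : ⁅F, E⁆ = -(q • u + p • v) := by rw [← lie_skew, hEF]
  have hCE : ⁅C, E⁆ = -⁅E, C⁆ := by rw [lie_skew]
  have e1 := key v B C u E
  have e2 := key u B C v E
  have e3 := key v E F v E
  have e4 := key u E F v E
  have e5 := key u E F u E
  have e6 := key v E B v C
  have e7 := key u E B v C
  have e8 := key u E B u C
  have guu : q * ip R g u u + p * ip R g u v = 0 := by
    have := ip_lie_left (R := R) u E F
    rw [huE, hEF, ip_add_right, ip_smul_right, ip_smul_right, ip_zero_left] at this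
    exact this.symm
  have gvv : r * ip R g u v + q * ip R g v v = 0 := by
    have := ip_lie_left (R := R) v B C
    rw [hvB, hBC, ip_add_right, ip_smul_right, ip_smul_right, ip_zero_left, ip_comm v u] at this
    exact this.symm
  simp only [huE, huB, huC, hvE, hvB, hvC, huv, hEB, hEF, hBC, huF', huB', huC',
    hvE', hvF', hvB', hvC', hvu, hBE, hFE, hCE, lie_self, lie_zero, zero_lie, lie_neg, neg_lie,
    add_lie, smul_lie, ip_zero_right, ip_neg_right, ip_add_right, ip_smul_right,
    kEF, kBC, kEE, kEB, kEC, kuE, kuF, kuB, kuC, kvE, kvF, kvB, kvC, ip_comm F E,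
    ip_comm B E, ip_comm C E, ip_comm E u, ip_comm F u, ip_comm B u, ip_comm C u, ip_comm E v,
    ip_comm F v, ip_comm B v, ip_comm C v, ip_comm v u, smul_zero, neg_zero]
    at e1 e2 e3 e4 e5 e6 e7 e8
  have self : ∀ a b, ip R g (K a b) b = 0 := fun a b ↦ self_eq_neg.mp (skew a b b)
  simp only [self, skew u E u, skew u E v, skew v E u, skew v E v, skew E v u, skew E F E,
    skew E C B, skew B E C] at e1 e2 e3 e4 e5 e6 e7 e8
  linear_combination (ip R g (Φ E F) E - ip R g (Φ E B) C) * (guu + gvv)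
    - (p + r) * (e7 - e4) - q * (e2 + e6 + e8 - e1 - e3 - e5)

end Curvature

section RootData

open LieModule LieAlgebra.IsKilling Module

variable {g : Type*} [LieRing g] [LieAlgebra ℂ g] [Module.Finite ℂ g]
  {H : LieSubalgebra ℂ g} [H.IsCartanSubalgebra]

theorem ip_eq_zero_of_mem_rootSpace {α β : H → ℂ} {x y : g} (hx : x ∈ rootSpace H α)
    (hy : y ∈ rootSpace H β) (hαβ : α + β ≠ 0) : ip ℂ g x y = 0 := by
  rw [ip, killingForm_apply_eq_zero_of_mem_rootSpace_of_add_ne_zero ℂ g H hx hy hαβ, neg_zero]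

/-- The extremal root of a root string. -/
theorem exists_weight_rootSpace_add_eq_bot {γ : Weight ℂ H g} (hγ : γ.IsNonZero)
    (α : Weight ℂ H g) :
    ∃ (β : Weight ℂ H g) (n : ℕ), (β : H → ℂ) = n • (γ : H → ℂ) + α ∧
      rootSpace H ((γ : H → ℂ) + β) = ⊥ := by
  classical
  have hex : ∃ k : ℕ, rootSpace H (k • (γ : H → ℂ) + α) = ⊥ := by
    obtain ⟨k, -, hk⟩ := exists_genWeightSpace_smul_add_eq_bot g (γ : H → ℂ) α hγ
    exact ⟨k, hk⟩
  obtain ⟨n, hn⟩ : ∃ n, Nat.find hex = n + 1 := by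
    refine Nat.exists_eq_succ_of_ne_zero fun h0 ↦ Weight.genWeightSpace_ne_bot g α ?_
    have := Nat.find_spec hex
    rwa [h0, zero_smul, zero_add] at this
  refine ⟨⟨n • (γ : H → ℂ) + α, Nat.find_min hex (by lia)⟩, n, rfl, ?_⟩
  have := Nat.find_spec hex
  rw [hn, add_comm n, add_smul, one_smul, add_assoc] at this
  exact this

variable [IsKilling ℂ g]

theorem killingForm_cartan_eq_sum (x y : H) :
    killingForm ℂ g x y = ∑ α ∈ H.root, α x * α y := by
  have := congr($(restrict_killingForm_eq_sum (K := ℂ) (L := g) (H := H)) x y)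
  simpa [LinearMap.BilinForm.restrict_apply, mul_comm] using this

theorem eq_zero_of_forall_weight_apply_eq_zero {x : H} (hx : ∀ α : Weight ℂ H g, α x = 0) :
    x = 0 := by
  have : x ∈ ⨅ α : Weight ℂ H g, α.ker :=
    (Submodule.mem_iInf _).mpr fun α ↦ by simpa using hx α
  rwa [iInf_ker_weight_eq_bot, Submodule.mem_bot] at this

/-- The Killing form is anisotropic on the real form of the Cartan subalgebra. -/
theorem eq_zero_of_killingForm_self_eq_zero {x : H} (hreal : ∀ α : Weight ℂ H g, (α x).im = 0)
    (hx : killingForm ℂ g x x = 0) : x = 0 := by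
  refine eq_zero_of_forall_weight_apply_eq_zero fun α ↦ ?_
  by_cases hα : α.IsNonZero
  · have hsum : ∑ α ∈ H.root, (α x).re * (α x).re = 0 := by
      have := congr(Complex.re $(hx))
      rw [killingForm_cartan_eq_sum, Complex.re_sum] at this
      simpa [hreal] using this
    have := (Finset.sum_eq_zero_iff_of_nonneg fun α _ ↦ mul_self_nonneg _).mp hsum α (by simpa)
    exact Complex.ext (by simpa using this) (by simpa using hreal α)
  · rw [Weight.IsNonZero, not_not] at hα
    simp [hα.eq]

theorem killingForm_cartanEquivDual_symm_apply (γ : Weight ℂ H g) (x : H) :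
    killingForm ℂ g ((cartanEquivDual H).symm γ.toLinear) x = γ x := by
  have : cartanEquivDual H ((cartanEquivDual H).symm γ.toLinear) x = γ x := by
    rw [LinearEquiv.apply_symm_apply, Weight.toLinear_apply]
  exact this

theorem weight_apply_cartanEquivDual_symm_comm (α γ : Weight ℂ H g) :
    α ((cartanEquivDual H).symm γ.toLinear) = γ ((cartanEquivDual H).symm α.toLinear) := by
  rw [← killingForm_cartanEquivDual_symm_apply, ← killingForm_cartanEquivDual_symm_apply,
    killingForm, LieModule.traceForm_comm]

theorem im_weight_apply_cartanEquivDual_symm (α γ : Weight ℂ H g) :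
    (α ((cartanEquivDual H).symm γ.toLinear)).im = 0 := by
  by_cases hγ : γ.IsNonZero
  · have him (β : Weight ℂ H g) : (β (coroot γ)).im = 0 := by
      rw [apply_coroot_eq_cast, Complex.intCast_im]
    have hne := root_apply_cartanEquivDual_symm_ne_zero hγ
    set T := (cartanEquivDual H).symm γ.toLinear with hT
    have hcoroot : coroot γ = (2 * (γ T)⁻¹) • T := by
      rw [coroot, ← hT, mul_smul, ofNat_smul_eq_nsmul ℂ 2]
    have hself : killingForm ℂ g (coroot γ) (coroot γ) = 4 * (γ T)⁻¹ := by
      have := killingForm_cartanEquivDual_symm_apply γ (coroot γ)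
      rw [← hT, root_apply_coroot hγ] at this
      nth_rw 1 [hcoroot]
      rw [SetLike.val_smul, map_smul, LinearMap.smul_apply, this, smul_eq_mul]
      ring
    have hγT : (γ T).im = 0 := by
      have h4 : (4 * (γ T)⁻¹).im = 0 := by
        rw [← hself, killingForm_cartan_eq_sum, Complex.im_sum]
        simp [him]
      have : γ T = 4 * (4 * (γ T)⁻¹)⁻¹ := by field_simp
      rw [this, Complex.mul_im, Complex.inv_im, h4]
      simp
    have : α T = γ T * α (coroot γ) / 2 := by
      rw [hcoroot]
      have : α ((2 * (γ T)⁻¹) • T) = (2 * (γ T)⁻¹) * α T := by simp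
      rw [this]
      field_simp
    rw [this, Complex.div_ofNat_im, Complex.mul_im, him, hγT]
    simp
  · rw [Weight.IsNonZero, not_not] at hγ
    simp [(Weight.coe_toLinear_eq_zero_iff ..).mpr hγ]

theorem exists_mem_rootSpace_neg_ip_eq_one {α : H → ℂ} {x : g} (hx : x ∈ rootSpace H α)
    (hx0 : x ≠ 0) : ∃ y ∈ rootSpace H (-α), ip ℂ g x y = 1 := by
  obtain ⟨y, hy, hxy⟩ : ∃ y ∈ rootSpace H (-α), ip ℂ g x y ≠ 0 := by
    by_contra! hcon
    refine hx0 ?_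
    have := mem_ker_killingForm_of_mem_rootSpace_of_forall_rootSpace_neg ℂ g H hx
      fun y hy ↦ by simpa [ip] using hcon y hy
    simpa using this
  exact ⟨(ip ℂ g x y)⁻¹ • y, Submodule.smul_mem _ _ hy, by rw [ip_smul_right, inv_mul_cancel₀ hxy]⟩

/-- For two non-proportional roots, the determinant of their Gram matrix does not vanish. -/
theorem gram_det_ne_zero {γ β : Weight ℂ H g} (hγ : γ.IsNonZero)
    (hprop : ∀ a : ℂ, (β : H → ℂ) ≠ a • (γ : H → ℂ)) :
    γ ((cartanEquivDual H).symm γ.toLinear) * β ((cartanEquivDual H).symm β.toLinear)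
      - γ ((cartanEquivDual H).symm β.toLinear) ^ 2 ≠ 0 := by
  intro hD
  have hP := root_apply_cartanEquivDual_symm_ne_zero hγ
  have hcomm := weight_apply_cartanEquivDual_symm_comm β γ
  have hreal := im_weight_apply_cartanEquivDual_symm (H := H) (g := g)
  have hκ := killingForm_cartanEquivDual_symm_apply (H := H) (g := g)
  set T := (cartanEquivDual H).symm γ.toLinear
  set S := (cartanEquivDual H).symm β.toLinear
  have happ (x : H) : killingForm ℂ g (γ T • S - γ S • T : H) x =
      γ T * β x - γ S * γ x := by
    rw [AddSubgroupClass.coe_sub, SetLike.val_smul, SetLike.val_smul, map_sub, map_smul, map_smul,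
      LinearMap.sub_apply, LinearMap.smul_apply, LinearMap.smul_apply, hκ, hκ, smul_eq_mul,
      smul_eq_mul]
  have hzero : γ T • S - γ S • T = 0 := by
    refine eq_zero_of_killingForm_self_eq_zero (fun α ↦ ?_) ?_
    · simp [Complex.mul_im, hreal, T, S]
    · rw [happ]
      simp only [map_sub, map_smul, smul_eq_mul, hcomm]
      linear_combination γ T * hD
  refine hprop (γ S / γ T) (funext fun x ↦ ?_)
  have := happ x
  rw [hzero] at this
  simp only [ZeroMemClass.coe_zero, map_zero, LinearMap.zero_apply] at this
  simp only [Pi.smul_apply, smul_eq_mul]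
  field_simp
  linear_combination -this

theorem weight_eq_smul_of_sq_eq_one {γ β : Weight ℂ H g} {ε : ℝ}
    (hε : ε ^ 2 = 1)
    (h : γ ((cartanEquivDual H).symm γ.toLinear) + β ((cartanEquivDual H).symm β.toLinear)
      - 2 * ε * γ ((cartanEquivDual H).symm β.toLinear) = 0) :
    (β : H → ℂ) = (ε : ℂ) • (γ : H → ℂ) := by
  have hcomm := weight_apply_cartanEquivDual_symm_comm β γ
  have hreal := im_weight_apply_cartanEquivDual_symm (H := H) (g := g)
  have hκ := killingForm_cartanEquivDual_symm_apply (H := H) (g := g)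
  set T := (cartanEquivDual H).symm γ.toLinear
  set S := (cartanEquivDual H).symm β.toLinear
  have happ (x : H) : killingForm ℂ g (S - (ε : ℂ) • T : H) x = β x - ε * γ x := by
    rw [AddSubgroupClass.coe_sub, SetLike.val_smul, map_sub, map_smul,
      LinearMap.sub_apply, LinearMap.smul_apply, hκ, hκ, smul_eq_mul]
  have hzero : S - (ε : ℂ) • T = 0 := by
    refine eq_zero_of_killingForm_self_eq_zero (fun α ↦ ?_) ?_
    · rw [map_sub, map_smul, smul_eq_mul, Complex.sub_im, Complex.im_ofReal_mul, hreal, hreal,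
        mul_zero, sub_zero]
    · have hε' : (ε : ℂ) ^ 2 = 1 := by exact_mod_cast hε
      rw [happ]
      simp only [map_sub, map_smul, smul_eq_mul, hcomm]
      linear_combination h + γ T * hε'
  refine funext fun x ↦ ?_
  have := happ x
  rw [hzero] at this
  simp only [ZeroMemClass.coe_zero, map_zero, LinearMap.zero_apply] at this
  simp only [Pi.smul_apply, smul_eq_mul]
  linear_combination -this

theorem sq_add_sub_four_mul_sq_ne_zero {γ β : Weight ℂ H g}
    (hprop : ∀ a : ℂ, (β : H → ℂ) ≠ a • (γ : H → ℂ)) :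
    (γ ((cartanEquivDual H).symm γ.toLinear) + β ((cartanEquivDual H).symm β.toLinear)) ^ 2
      - 4 * γ ((cartanEquivDual H).symm β.toLinear) ^ 2 ≠ 0 := by
  intro h
  rw [show (4 : ℂ) = 2 ^ 2 by norm_num, ← mul_pow, sq_sub_sq, mul_eq_zero] at h
  rcases h with h | h
  · exact hprop _ (weight_eq_smul_of_sq_eq_one (ε := -1) (by norm_num)
      (by push_cast; linear_combination h))
  · exact hprop _ (weight_eq_smul_of_sq_eq_one (ε := 1) (by norm_num)
      (by push_cast; linear_combination h))

theorem ip_apply_eq_zero_of_mem_rootSpace {K : g →ₗ[ℂ] Module.End ℂ g}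
    (hskew : ∀ Z X Y : g, ip ℂ g (K Z X) Y + ip ℂ g X (K Z Y) = 0)
    {Φ : g →ₗ[ℂ] g →ₗ[ℂ] g}
    (hii : ∀ X Y Z : g,
      (⁅ad ℂ g ⁅X, Y⁆, K Z⁆ + ad ℂ g ⁅K X Y - K Y X, Z⁆ + wedge ℂ g (Φ X Y) Z)
      + (⁅ad ℂ g ⁅Y, Z⁆, K X⁆ + ad ℂ g ⁅K Y Z - K Z Y, X⁆ + wedge ℂ g (Φ Y Z) X)
      + (⁅ad ℂ g ⁅Z, X⁆, K Y⁆ + ad ℂ g ⁅K Z X - K X Z, Y⁆ + wedge ℂ g (Φ Z X) Y) = 0)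
    {X Y : H} (hXY : LinearIndependent ℂ ![X, Y]) (hspan : ∀ x : H, ∃ a b : ℂ, a • X + b • Y = x)
    {γ : Weight ℂ H g} (hγ : γ.IsNonZero) {E : g} (hE : E ∈ rootSpace H γ) :
    ip ℂ g (K E X) Y = 0 := by
  rcases eq_or_ne E 0 with rfl | hE0
  · simp [ip_zero_left]
  have hx0 : γ X • Y - γ Y • X ≠ 0 := by
    intro h
    have := LinearIndependent.pair_iff.mp hXY (-γ Y) (γ X) (by rw [← h]; module)
    refine hγ (funext fun x ↦ ?_)
    obtain ⟨a, b, rfl⟩ := hspan x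
    simp [this.2, neg_eq_zero.mp this.1]
  obtain ⟨α, hα⟩ : ∃ α : Weight ℂ H g, α (γ X • Y - γ Y • X) ≠ 0 := by
    by_contra! hcon
    exact hx0 (eq_zero_of_forall_weight_apply_eq_zero hcon)
  obtain ⟨β, n, hβ, hbot⟩ := exists_weight_rootSpace_add_eq_bot hγ α
  have hc : γ X * β Y - γ Y * β X ≠ 0 := by
    simp only [map_sub, map_smul, smul_eq_mul] at hα
    simp only [hβ, Pi.add_apply, Pi.smul_apply, ← Nat.cast_smul_eq_nsmul ℂ n, smul_eq_mul]
    convert hα using 1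
    ring
  have hprop (a : ℂ) : (β : H → ℂ) ≠ a • (γ : H → ℂ) := by
    intro h
    refine hc ?_
    simp only [h, Pi.smul_apply, smul_eq_mul]
    ring
  have hγ0 : (γ : H → ℂ) ≠ 0 := hγ
  have hβ0 : (β : H → ℂ) ≠ 0 := fun h ↦ hprop 0 (by rw [h, zero_smul])
  have hγβ : (γ : H → ℂ) + β ≠ 0 := fun h ↦ hprop (-1) (by
    rw [neg_one_smul]; exact (neg_eq_of_add_eq_zero_right h).symm)
  have hγβ' : (γ : H → ℂ) + -β ≠ 0 := fun h ↦ hprop 1 (by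
    rw [one_smul]; exact (add_neg_eq_zero.mp h).symm)
  have hγγ : (γ : H → ℂ) + γ ≠ 0 := fun h ↦ hγ0 (self_eq_neg.mp (eq_neg_of_add_eq_zero_left h))
  obtain ⟨F, hF, kEF⟩ := exists_mem_rootSpace_neg_ip_eq_one hE hE0
  obtain ⟨B, hB, hB0⟩ := β.exists_ne_zero
  obtain ⟨C, hC, kBC⟩ := exists_mem_rootSpace_neg_ip_eq_one hB hB0
  have hEF := lie_eq_killingForm_smul_of_mem_rootSpace_of_mem_rootSpace_neg hE hF
  have hBC := lie_eq_killingForm_smul_of_mem_rootSpace_of_mem_rootSpace_neg hB hC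
  rw [show killingForm ℂ g E F = -1 from neg_eq_iff_eq_neg.mp kEF] at hEF
  rw [show killingForm ℂ g B C = -1 from neg_eq_iff_eq_neg.mp kBC] at hBC
  have hEB : ⁅E, B⁆ = 0 := by
    have : ⁅E, B⁆ ∈ rootSpace H ((γ : H → ℂ) + β) :=
      LieAlgebra.lie_mem_genWeightSpace_of_mem_genWeightSpace hE hB
    rwa [hbot, LieSubmodule.mem_bot] at this
  have hD := gram_det_ne_zero hγ hprop
  have hpqr := sq_add_sub_four_mul_sq_ne_zero hprop
  have hcomm := weight_apply_cartanEquivDual_symm_comm β γ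
  change ⁅E, F⁆ = (-1 : ℂ) • ((cartanEquivDual H).symm γ.toLinear : g) at hEF
  change ⁅B, C⁆ = (-1 : ℂ) • ((cartanEquivDual H).symm β.toLinear : g) at hBC
  set T := (cartanEquivDual H).symm γ.toLinear
  set S := (cartanEquivDual H).symm β.toLinear
  set D := γ T * β S - γ S ^ 2 with hDdef
  set u : H := D⁻¹ • (γ T • S - γ S • T) with hu
  set v : H := D⁻¹ • (β S • T - γ S • S) with hv
  have hγu : γ u = 0 := by
    simp only [hu, map_smul, map_sub, smul_eq_mul]
    ring
  have hβu : β u = 1 := by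
    simp only [hu, map_smul, map_sub, smul_eq_mul, hcomm]
    field_simp
    linear_combination -hDdef
  have hγv : γ v = 1 := by
    simp only [hv, map_smul, map_sub, smul_eq_mul]
    field_simp
    linear_combination -hDdef
  have hβv : β v = 0 := by
    simp only [hv, map_smul, map_sub, smul_eq_mul, hcomm]
    ring
  have hT : T = γ S • u + γ T • v := by
    have : T = (D⁻¹ * (γ T * β S - γ S ^ 2)) • T := by
      rw [← hDdef, inv_mul_cancel₀ hD, one_smul]
    nth_rw 1 [this]
    rw [hu, hv]
    module
  have hS : S = β S • u + γ S • v := by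
    have : S = (D⁻¹ * (γ T * β S - γ S ^ 2)) • S := by
      rw [← hDdef, inv_mul_cancel₀ hD, one_smul]
    nth_rw 1 [this]
    rw [hu, hv]
    module
  have hroot {χ : H → ℂ} {x : g} (hx : x ∈ rootSpace H χ) (w : H) : ⁅(w : g), x⁆ = χ w • x :=
    lie_eq_smul_of_mem_rootSpace hx w
  have horth {χ : H → ℂ} (hχ : χ ≠ 0) {x : g} (hx : x ∈ rootSpace H χ) (w : H) :
      ip ℂ g w x = 0 :=
    ip_eq_zero_of_mem_rootSpace (α := 0) (by simp) hx (by rwa [zero_add])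
  have huv : ip ℂ g (K E u) v = 0 := by
    refine (mul_eq_zero.mp (mul_ip_rootVector_eq_zero hskew hii (p := -γ T) (q := -γ S)
      (r := -β S) (E := E) (F := F) (B := B) (C := C) ?_ ?_ ?_ ?_ ?_ ?_ ?_ ?_ ?_ hEB ?_ ?_ kEF kBC
      (ip_eq_zero_of_mem_rootSpace hE hE hγγ) (ip_eq_zero_of_mem_rootSpace hE hB hγβ)
      (ip_eq_zero_of_mem_rootSpace hE hC hγβ') (horth hγ0 hE u)
      (horth (neg_ne_zero.mpr hγ0) hF u) (horth hβ0 hB u) (horth (neg_ne_zero.mpr hβ0) hC u)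
      (horth hγ0 hE v) (horth (neg_ne_zero.mpr hγ0) hF v) (horth hβ0 hB v)
      (horth (neg_ne_zero.mpr hβ0) hC v))).resolve_left ?_
    · simp [hroot hE, hγu]
    · simp [hroot hF, hγu]
    · simp [hroot hB, hβu]
    · simp [hroot hC, hβu]
    · simp [hroot hE, hγv]
    · simp [hroot hF, hγv]
    · simp [hroot hB, hβv]
    · simp [hroot hC, hβv]
    · rw [← LieSubalgebra.coe_bracket, trivial_lie_zero, ZeroMemClass.coe_zero]
    · rw [hEF, congr((($hT : H) : g))]
      push_cast
      module
    · rw [hBC, congr((($hS : H) : g))]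
      push_cast
      module
    · exact fun h ↦ hpqr (by linear_combination h)
  obtain ⟨a, b, hab⟩ := hspan u
  obtain ⟨a', b', hab'⟩ := hspan v
  have skew (x y : g) : ip ℂ g (K E x) y = -ip ℂ g (K E y) x := by
    rw [eq_neg_iff_add_eq_zero, ip_comm (K E y)]
    exact hskew E x y
  have self (x : g) : ip ℂ g (K E x) x = 0 := self_eq_neg.mp (skew x x)
  have hdet : a * b' - b * a' ≠ 0 := by
    intro h
    have : β u * γ v - β v * γ u = (a * b' - b * a') * (β X * γ Y - β Y * γ X) := by
      simp only [← hab, ← hab', map_add, map_smul, smul_eq_mul]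
      ring
    simp [h, hγu, hγv, hβu, hβv] at this
  refine (mul_eq_zero.mp ?_).resolve_left hdet
  rw [← huv, ← hab, ← hab']
  push_cast
  simp only [map_add, map_smul, ip_add_left, ip_add_right, ip_smul_left, ip_smul_right, self,
    skew Y X]
  ring

theorem apply_eq_zero_of_forall_rootSpace {f : g →ₗ[ℂ] ℂ}
    (hf : ∀ γ : Weight ℂ H g, γ.IsNonZero → ∀ x ∈ rootSpace H γ, f x = 0)
    {x : g} (hx : ∀ y ∈ H, killingForm ℂ g x y = 0) : f x = 0 := by
  have hmem : x ∈ H.toSubmodule ⊔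
      ⨆ α : Weight ℂ H g, ⨆ (_ : α.IsNonZero), (rootSpace H α).toSubmodule := by
    have : x ∈ (⊤ : LieSubmodule ℂ H g) := LieSubmodule.mem_top x
    rw [← cartan_sup_iSup_rootSpace_eq_top (K := ℂ) (L := g) (H := H),
      ← LieSubmodule.mem_toSubmodule] at this
    simp only [LieSubmodule.sup_toSubmodule, LieSubmodule.iSup_toSubmodule] at this
    exact this
  obtain ⟨a, ha, b, hb, rfl⟩ := Submodule.mem_sup.mp hmem
  have hfb : f b = 0 := by
    rw [← LinearMap.mem_ker]
    refine (iSup₂_le fun α hα ↦ ?_ : _ ≤ LinearMap.ker f) hb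
    exact fun y hy ↦ hf α hα y hy
  have hκb (y : g) (hy : y ∈ H) : killingForm ℂ g y b = 0 := by
    rw [← LinearMap.mem_ker]
    refine (iSup₂_le fun α hα ↦ ?_ : _ ≤ LinearMap.ker (killingForm ℂ g y)) hb
    intro z hz
    refine killingForm_apply_eq_zero_of_mem_rootSpace_of_add_ne_zero ℂ g H (α := 0) ?_ hz ?_
    · simpa using hy
    · rw [zero_add]; exact hα
  have ha0 : (⟨a, ha⟩ : H) = 0 := by
    have : (⟨a, ha⟩ : H) ∈ LinearMap.ker ((killingForm ℂ g).restrict H.toSubmodule) := by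
      refine LinearMap.mem_ker.mpr (LinearMap.ext fun y ↦ ?_)
      have h1 := hx y y.2
      rw [map_add, LinearMap.add_apply, killingForm, LieModule.traceForm_comm ℂ g g b] at h1
      have h2 := hκb y y.2
      rw [killingForm] at h2
      rw [h2, add_zero] at h1
      exact h1
    rwa [ker_restrict_eq_bot_of_isCartanSubalgebra, Submodule.mem_bot] at this
  have : a = 0 := congr(($ha0 : g))
  rw [this, zero_add, hfb]

end RootData

theorem stmt_13 (g : Type*) [LieRing g] [LieAlgebra ℂ g] [Module.Finite ℂ g]
    [LieAlgebra.IsSimple ℂ g]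
    (K : g →ₗ[ℂ] Module.End ℂ g)
    (hskew : ∀ Z X Y : g, ip ℂ g (K Z X) Y + ip ℂ g X (K Z Y) = 0)
    (htr : ∀ Z U : g, LinearMap.trace ℂ g (K Z ∘ₗ ad ℂ g U) = 0)
    (Φ : g →ₗ[ℂ] g →ₗ[ℂ] g)
    (hΦalt : ∀ X : g, Φ X X = 0)
    (hi : ∀ X Y Z : g, ip ℂ g (Φ X Y) Z + ip ℂ g (Φ Y Z) X + ip ℂ g (Φ Z X) Y = 0)
    (hii : ∀ X Y Z : g,
      (⁅ad ℂ g ⁅X, Y⁆, K Z⁆ + ad ℂ g ⁅K X Y - K Y X, Z⁆ + wedge ℂ g (Φ X Y) Z)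
      + (⁅ad ℂ g ⁅Y, Z⁆, K X⁆ + ad ℂ g ⁅K Y Z - K Z Y, X⁆ + wedge ℂ g (Φ Y Z) X)
      + (⁅ad ℂ g ⁅Z, X⁆, K Y⁆ + ad ℂ g ⁅K Z X - K X Z, Y⁆ + wedge ℂ g (Φ Z X) Y) = 0)
    (hrank : ∃ h : LieSubalgebra ℂ g, h.IsCartanSubalgebra ∧ Module.finrank ℂ h = 2)
    (h : LieSubalgebra ℂ g) (hh : h.IsCartanSubalgebra)
    (X Y : g) (hXY : Submodule.span ℂ ({X, Y} : Set g) = h.toSubmodule)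
    (Z : g) (hZ : ∀ W ∈ h, killingForm ℂ g Z W = 0) :
    ip ℂ g (K Z X) Y = 0 := by
  have := hh
  have hX : X ∈ h := by
    have : X ∈ h.toSubmodule := hXY ▸ Submodule.subset_span (by simp)
    exact this
  have hY : Y ∈ h := by
    have : Y ∈ h.toSubmodule := hXY ▸ Submodule.subset_span (by simp)
    exact this
  have skew (A B C : g) : ip ℂ g (K A B) C = -ip ℂ g (K A C) B := by
    rw [eq_neg_iff_add_eq_zero, ip_comm (K A C)]
    exact hskew A B C
  have self (A B : g) : ip ℂ g (K A B) B = 0 := self_eq_neg.mp (skew A B B)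
  by_cases hli : LinearIndependent ℂ ![(⟨X, hX⟩ : h), ⟨Y, hY⟩]
  · obtain ⟨f, hf⟩ : ∃ f : g →ₗ[ℂ] ℂ, ∀ A, f A = ip ℂ g (K A X) Y :=
      ⟨-((killingForm ℂ g).flip Y ∘ₗ K.flip X), fun A ↦ rfl⟩
    rw [← hf]
    refine apply_eq_zero_of_forall_rootSpace (fun γ hγ E hE ↦ ?_) hZ
    rw [hf]
    refine ip_apply_eq_zero_of_mem_rootSpace hskew hii hli (fun x ↦ ?_) hγ hE
    have hx : (x : g) ∈ Submodule.span ℂ {X, Y} := hXY ▸ x.2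
    obtain ⟨a, b, hab⟩ := Submodule.mem_span_pair.mp hx
    exact ⟨a, b, Subtype.ext hab⟩
  · rw [LinearIndependent.pair_iff] at hli
    push Not at hli
    obtain ⟨a, b, hab, hne⟩ := hli
    replace hab : a • X + b • Y = 0 := congrArg Subtype.val hab
    have h1 : b * ip ℂ g (K Z X) Y = 0 := by
      have := congr(ip ℂ g (K Z X) $hab)
      rwa [ip_add_right, ip_smul_right, ip_smul_right, self, mul_zero, zero_add,
        ip_zero_right] at this
    have h2 : a * ip ℂ g (K Z X) Y = 0 := by
      have := congr(ip ℂ g (K Z $hab) Y)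
      rwa [map_add, map_smul, map_smul, ip_add_left, ip_smul_left, ip_smul_left, self, mul_zero,
        add_zero, map_zero, ip_zero_left] at this
    by_cases ha : a = 0
    · exact (mul_eq_zero.mp h1).resolve_left (hne ha)
    · exact (mul_eq_zero.mp h2).resolve_left ha
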